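/- Let L be a free abelian group of rank 2n with an action of the dihedral group D = ⟨t,u⟩ of order 8 whose central involution acts as -1. Let B(t) and B(u) be the images of L(t-1) and L(u-1) in L/2Tel(t) (i.e., B(g) = (L(g-1) + 2Tel(t))/2Tel(t)). Then B(t) ∩ B(u) = 0, and consequently |B(t)+B(u)| = |B(t)|·|B(u)| = 2^(n+3d+e), where d, e count the Jordan blocks of sizes 2, 1 for u on L/Tel(t). -/

import Mathlib

/-- The `+1`-eigenlattice of an involution `t` on `L`. -/
def eigP {L : Type*} [AddCommGroup L] (t : Module.End ℤ L) : Submodule ℤ L :=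
  LinearMap.ker (t - 1)

/-- The `-1`-eigenlattice of an involution `t` on `L`. -/
def eigM {L : Type*} [AddCommGroup L] (t : Module.End ℤ L) : Submodule ℤ L :=
  LinearMap.ker (t + 1)

/-- The total eigenlattice `Tel(t) = L^+(t) + L^-(t)`. -/
def Tel {L : Type*} [AddCommGroup L] (t : Module.End ℤ L) : Submodule ℤ L :=
  eigP t ⊔ eigM t


/-- The doubled total eigenlattice `2·Tel(t)`. -/
def twoTel {L : Type*} [AddCommGroup L] (t : Module.End ℤ L) : Submodule ℤ L :=
  Submodule.map ((2 : ℤ) • (1 : Module.End ℤ L)) (Tel t)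

/-- The commutator module `B(g) = (L(g-1) + 2Tel(t))/2Tel(t)` inside `L/2Tel(t)`. -/
def Bmod {L : Type*} [AddCommGroup L] (t g : Module.End ℤ L) :
    Submodule ℤ (L ⧸ twoTel t) :=
  Submodule.map (twoTel t).mkQ (LinearMap.range (g - 1))

section Cardinality

variable {R M N P : Type*} [Ring R] [AddCommGroup M] [AddCommGroup N] [AddCommGroup P]
  [Module R M] [Module R N] [Module R P]

lemma natCard_eq_natCard_ker_mul_natCard_range (f : M →ₗ[R] N) :
    Nat.card M = Nat.card (LinearMap.ker f) * Nat.card (LinearMap.range f) := by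
  rw [Submodule.card_eq_card_quotient_mul_card (LinearMap.ker f),
    Nat.card_congr f.quotKerEquivRange.toEquiv]

lemma natCard_range_eq_of_ker_eq (f : M →ₗ[R] N) (g : M →ₗ[R] P)
    (h : LinearMap.ker f = LinearMap.ker g) :
    Nat.card (LinearMap.range f) = Nat.card (LinearMap.range g) :=
  Nat.card_congr (f.quotKerEquivRange.symm.trans
    ((Submodule.quotEquivOfEq _ _ h).trans g.quotKerEquivRange)).toEquiv

lemma natCard_sup_of_disjoint {S T : Submodule R M} (h : Disjoint S T) :
    Nat.card (S ⊔ T : Submodule R M) = Nat.card S * Nat.card T := by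
  have hinj : Function.Injective (S.subtype.coprod T.subtype) := by
    rw [← LinearMap.ker_eq_bot, LinearMap.ker_coprod_of_disjoint_range]
    · simp
    · simpa using h
  rw [Submodule.sup_eq_range, ← Nat.card_prod,
    Nat.card_congr (LinearEquiv.ofInjective _ hinj).toEquiv]

/-- Restricting `g` to a submodule `S` splits the cardinality of `S`. -/
lemma natCard_eq_natCard_ker_inf_mul_natCard_map (S : Submodule R M) (g : M →ₗ[R] N) :
    Nat.card S = Nat.card (LinearMap.ker g ⊓ S : Submodule R M) * Nat.card (S.map g) := by
  rw [natCard_eq_natCard_ker_mul_natCard_range (g.domRestrict S), LinearMap.range_domRestrict,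
    LinearMap.ker_domRestrict]
  congr 1
  rw [inf_comm, ← Submodule.map_comap_subtype]
  exact Nat.card_congr (Submodule.equivMapOfInjective S.subtype S.injective_subtype _).toEquiv

end Cardinality

/-- Any homomorphism out of `ℤ^r` with kernel `2ℤ^r` has image of order `2^r`. -/
lemma natCard_range_of_ker_eq_two_smul {M N : Type*} [AddCommGroup M] [AddCommGroup N]
    [Module.Free ℤ M] [Module.Finite ℤ M] (f : M →ₗ[ℤ] N)
    (h : ∀ x, f x = 0 ↔ ∃ y, x = (2 : ℤ) • y) :
    Nat.card (LinearMap.range f) = 2 ^ Module.finrank ℤ M := by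
  let b := Module.finBasis ℤ M
  let g : M →ₗ[ℤ] (Fin (Module.finrank ℤ M) → ZMod 2) :=
    LinearMap.pi fun i => (Int.castAddHom (ZMod 2)).toIntLinearMap ∘ₗ b.coord i
  have hg (x i) : g x i = ((b.repr x i : ℤ) : ZMod 2) := rfl
  have hsurj : Function.Surjective g := fun v => by
    refine ⟨b.equivFun.symm fun i => ((v i).val : ℤ), funext fun i => ?_⟩
    rw [hg, ← b.equivFun_apply, LinearEquiv.apply_symm_apply]
    simp
  have hker : LinearMap.ker f = LinearMap.ker g := by
    ext x
    rw [LinearMap.mem_ker, LinearMap.mem_ker, h]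
    constructor
    · rintro ⟨y, rfl⟩
      ext i
      rw [hg, map_smul, Finsupp.smul_apply, smul_eq_mul, Int.cast_mul]
      simp [show (2 : ZMod 2) = 0 from rfl]
    · intro hx
      have hx' (i) : ∃ c : ℤ, b.repr x i = 2 * c :=
        (ZMod.intCast_zmod_eq_zero_iff_dvd _ 2).1 (by rw [← hg, hx]; rfl)
      choose c hc using hx'
      refine ⟨b.equivFun.symm c, b.equivFun.injective (funext fun i => ?_)⟩
      rw [map_smul, LinearEquiv.apply_symm_apply, b.equivFun_apply, hc]
      simp
  rw [natCard_range_eq_of_ker_eq f g hker, LinearMap.range_eq_top.2 hsurj,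
    Nat.card_congr (LinearEquiv.ofTop (⊤ : Submodule ℤ _) rfl).toEquiv]
  simp

section Dihedral

variable {L : Type*} [AddCommGroup L] {t u : Module.End ℤ L}

lemma mem_eigP {x : L} : x ∈ eigP t ↔ t x = x := by
  simp [eigP, sub_eq_zero]

lemma mem_eigM {x : L} : x ∈ eigM t ↔ t x = -x := by
  simp [eigM, add_eq_zero_iff_eq_neg]

lemma mem_twoTel {x : L} : x ∈ twoTel t ↔ ∃ y ∈ Tel t, (2 : ℤ) • y = x :=
  Iff.rfl

lemma twoTel_le_Tel : twoTel t ≤ Tel t := by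
  intro x hx
  obtain ⟨y, hy, rfl⟩ := mem_twoTel.1 hx
  exact (Tel t).smul_mem 2 hy

lemma involution_apply_apply (ht : t * t = 1) (x : L) : t (t x) = x := by
  simpa using congr($ht x)

lemma anticommute_apply (ht : t * t = 1) (hu : u * u = 1) (hz : (t * u) * (t * u) = -1) (x : L) :
    u (t x) = -t (u x) := by
  have h : t (u (t (u (u x)))) = -u x := by simpa using congr($hz (u x))
  rw [involution_apply_apply hu] at h
  rw [← map_neg, ← h, involution_apply_apply ht]

/-- Since `u` exchanges the eigenlattices of `t`, `Tel(t) = L^+(t) ⊕ L^+(t)u`. -/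
lemma mem_Tel_iff (hu : u * u = 1) (hut : ∀ x, u (t x) = -t (u x)) {x : L} :
    x ∈ Tel t ↔ ∃ p ∈ eigP t, ∃ q ∈ eigP t, p + u q = x := by
  rw [Tel, Submodule.mem_sup]
  refine exists_congr fun p => and_congr_right fun _ => ?_
  constructor
  · rintro ⟨q, hq, rfl⟩
    rw [mem_eigM] at hq
    refine ⟨u q, mem_eigP.2 ?_, by rw [involution_apply_apply hu]⟩
    rw [← neg_eq_iff_eq_neg.2 (hut q), hq, map_neg, neg_neg]
  · rintro ⟨q, hq, rfl⟩
    rw [mem_eigP] at hq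
    exact ⟨u q, mem_eigM.2 (by rw [← neg_eq_iff_eq_neg.2 (hut q), hq]), rfl⟩

lemma natCard_quotient_Tel (hu : u * u = 1) (hut : ∀ x, u (t x) = -t (u x)) :
    Nat.card (L ⧸ Tel t) =
      Nat.card (Submodule.map (Tel t).mkQ (Submodule.comap (u - 1) (Tel t))) *
      Nat.card (Submodule.map (Tel t).mkQ (LinearMap.range (u - 1))) := by
  have hinv : Tel t ≤ (Tel t).comap (u - 1) := by
    intro x hx
    refine sub_mem ?_ hx
    obtain ⟨p, hp, q, hq, rfl⟩ := (mem_Tel_iff hu hut).1 hx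
    exact (mem_Tel_iff hu hut).2 ⟨q, hq, p, hp, by
      rw [map_add, involution_apply_apply hu, add_comm]⟩
  rw [natCard_eq_natCard_ker_mul_natCard_range ((Tel t).mapQ (Tel t) (u - 1) hinv),
    Submodule.mapQ, Submodule.ker_liftQ, Submodule.range_liftQ, LinearMap.ker_comp,
    Submodule.ker_mkQ, LinearMap.range_comp]

variable [Module.Free ℤ L]

lemma eq_of_two_smul_eq {x y : L} (h : (2 : ℤ) • x = (2 : ℤ) • y) : x = y :=
  smul_right_injective L (by norm_num : (2 : ℤ) ≠ 0) h

lemma eq_and_eq_of_add_apply_eq (hu : u * u = 1) (hut : ∀ x, u (t x) = -t (u x))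
    {p q p' q' : L} (hp : p ∈ eigP t) (hq : q ∈ eigP t) (hp' : p' ∈ eigP t) (hq' : q' ∈ eigP t)
    (h : p + u q = p' + u q') : p = p' ∧ q = q' := by
  rw [mem_eigP] at hp hq hp' hq'
  have h₂ := congrArg t h
  have hq₂ := hut q
  have hq₂' := hut q'
  rw [hq] at hq₂
  rw [hq'] at hq₂'
  rw [map_add, map_add, hp, hp', ← neg_eq_iff_eq_neg.2 hq₂, ← neg_eq_iff_eq_neg.2 hq₂'] at h₂
  have hpp : p = p' := eq_of_two_smul_eq (by
    rw [two_smul, two_smul]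
    have := congrArg₂ (· + ·) h h₂
    abel_nf at this ⊢
    exact this)
  subst hpp
  refine ⟨rfl, ?_⟩
  rw [← involution_apply_apply hu q, ← involution_apply_apply hu q', add_left_cancel h]

/-- `(t-1)x ∈ 2Tel(t)` exactly when `x ∈ Tel(t)`. -/
lemma sub_apply_mem_twoTel_iff (ht : t * t = 1) {x : L} :
    t x - x ∈ twoTel t ↔ x ∈ Tel t := by
  constructor
  · intro h
    obtain ⟨y, hy, hyx⟩ := mem_twoTel.1 h
    obtain ⟨p, hp, q, hq, rfl⟩ := Submodule.mem_sup.1 hy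
    have h₂ := congrArg t hyx
    rw [map_smul, map_add, map_sub, mem_eigP.1 hp, mem_eigM.1 hq,
      involution_apply_apply ht] at h₂
    have hfix : x + q ∈ eigP t := by
      rw [mem_eigP, map_add, mem_eigM.1 hq]
      apply eq_of_two_smul_eq
      linear_combination (norm := module) h₂ - hyx
    exact Submodule.mem_sup.2 ⟨x + q, hfix, -q, neg_mem hq, by abel⟩
  · intro h
    obtain ⟨p, hp, q, hq, rfl⟩ := Submodule.mem_sup.1 h
    refine mem_twoTel.2 ⟨-q, Submodule.mem_sup_right (neg_mem hq), ?_⟩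
    rw [map_add, mem_eigP.1 hp, mem_eigM.1 hq]
    module

lemma disjoint_Bmod (ht : t * t = 1) (hu : u * u = 1) (hut : ∀ x, u (t x) = -t (u x)) :
    Disjoint (Bmod t t) (Bmod t u) := by
  rw [Submodule.disjoint_def]
  rintro _ ⟨_, ⟨x, rfl⟩, rfl⟩ ⟨_, ⟨y, rfl⟩, hxy⟩
  simp only [LinearMap.sub_apply, Module.End.one_apply, Submodule.mkQ_apply] at hxy ⊢
  obtain ⟨w, hw, hwx⟩ := mem_twoTel.1 ((Submodule.Quotient.eq _).1 hxy.symm)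
  obtain ⟨p, hp, q, hq, rfl⟩ := (mem_Tel_iff hu hut).1 hw
  have hpq : p + q ∈ eigP t := add_mem hp hq
  have hr : u (t x - x) ∈ eigP t := by
    rw [mem_eigP, map_sub, map_sub, hut, map_neg, involution_apply_apply ht,
      ← neg_eq_iff_eq_neg.2 (hut x), hut]
    abel
  have huw := congrArg u hwx
  simp only [map_smul, map_add, map_sub, involution_apply_apply hu] at huw
  have key := eq_and_eq_of_add_apply_eq hu hut hr hr ((eigP t).smul_mem 2 hpq)
    ((eigP t).smul_mem 2 hpq) (by
      simp only [map_smul, map_add, map_sub, involution_apply_apply hu]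
      linear_combination (norm := module) -hwx - huw)
  rw [Submodule.Quotient.mk_eq_zero]
  refine mem_twoTel.2 ⟨u (p + q),
    (mem_Tel_iff hu hut).2 ⟨0, zero_mem _, p + q, hpq, zero_add _⟩, ?_⟩
  rw [← map_smul, ← key.1, involution_apply_apply hu]

lemma natCard_Bmod_self (ht : t * t = 1) : Nat.card (Bmod t t) = Nat.card (L ⧸ Tel t) := by
  rw [Bmod, ← LinearMap.range_comp, ← Nat.card_congr
    (LinearEquiv.ofTop (LinearMap.range (Tel t).mkQ) (Submodule.range_mkQ _)).toEquiv]
  apply natCard_range_eq_of_ker_eq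
  ext x
  exact (Submodule.Quotient.mk_eq_zero _).trans
    ((sub_apply_mem_twoTel_iff ht).trans (Submodule.Quotient.mk_eq_zero _).symm)

lemma two_mul_finrank_eigP [Module.Finite ℤ L] (ht : t * t = 1) (hu : u * u = 1)
    (hut : ∀ x, u (t x) = -t (u x)) :
    2 * Module.finrank ℤ (eigP t) = Module.finrank ℤ L := by
  have hprod : Module.finrank ℤ (eigP t × eigP t) = 2 * Module.finrank ℤ (eigP t) := by
    rw [Module.finrank_prod, two_mul]
  rw [← hprod]
  apply le_antisymm
  · let f : eigP t × eigP t →ₗ[ℤ] L := (eigP t).subtype.coprod (u ∘ₗ (eigP t).subtype)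
    refine LinearMap.finrank_le_finrank_of_injective (f := f) ?_
    rintro ⟨p, q⟩ ⟨p', q'⟩ h
    have := eq_and_eq_of_add_apply_eq hu hut p.2 q.2 p'.2 q'.2 (by simpa [f] using h)
    exact Prod.ext (Subtype.ext this.1) (Subtype.ext this.2)
  · have h₁ (x : L) : (1 + t) x ∈ eigP t := by
      simp [mem_eigP, involution_apply_apply ht, add_comm]
    have h₂ (x : L) : (u * (1 - t)) x ∈ eigP t := by
      have : t (u (x - t x)) = u (x - t x) := by
        rw [← neg_eq_iff_eq_neg.2 (hut _), map_sub, involution_apply_apply ht, ← map_neg, neg_sub]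
      exact mem_eigP.2 this
    refine LinearMap.finrank_le_finrank_of_injective
      (f := ((1 + t).codRestrict _ h₁).prod ((u * (1 - t)).codRestrict _ h₂)) ?_
    intro x y h
    have e₁ : x + t x = y + t y := congrArg Subtype.val (congrArg Prod.fst h)
    have e₂ : u (x - t x) = u (y - t y) := congrArg Subtype.val (congrArg Prod.snd h)
    have e₃ := congrArg u e₂
    rw [involution_apply_apply hu, involution_apply_apply hu] at e₃
    apply eq_of_two_smul_eq
    linear_combination (norm := module) e₁ + e₃

/-- The part of `B(u)` that lies in `Tel(t)/2Tel(t)` is the image of `L^+(t)(u-1)`. -/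
lemma ker_factor_inf_Bmod (hu : u * u = 1) (hut : ∀ x, u (t x) = -t (u x)) :
    LinearMap.ker (Submodule.factor (twoTel_le_Tel (t := t))) ⊓ Bmod t u =
      LinearMap.range ((twoTel t).mkQ ∘ₗ (u - 1) ∘ₗ (eigP t).subtype) := by
  apply le_antisymm
  · rintro _ ⟨hx, _, ⟨x, rfl⟩, rfl⟩
    have hx' : u x - x ∈ Tel t := (Submodule.Quotient.mk_eq_zero _).1 hx
    obtain ⟨p, hp, q, hq, hpq⟩ := (mem_Tel_iff hu hut).1 hx'
    have hpq₂ := congrArg u hpq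
    rw [map_add, map_sub, involution_apply_apply hu, involution_apply_apply hu] at hpq₂
    obtain ⟨rfl, -⟩ := eq_and_eq_of_add_apply_eq hu hut hp hq (neg_mem hq) (neg_mem hp) (by
      rw [map_neg]
      linear_combination (norm := module) hpq + hpq₂)
    refine ⟨⟨q, hq⟩, ?_⟩
    simp only [LinearMap.comp_apply, LinearMap.sub_apply, Module.End.one_apply,
      Submodule.subtype_apply]
    rw [← hpq, neg_add_eq_sub]
  · rintro _ ⟨a, rfl⟩
    refine ⟨?_, Submodule.mem_map_of_mem ⟨a, rfl⟩⟩
    have : u a - a ∈ Tel t :=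
      (mem_Tel_iff hu hut).2 ⟨-a, neg_mem a.2, a, a.2, neg_add_eq_sub _ _⟩
    exact (Submodule.Quotient.mk_eq_zero _).2 this

lemma natCard_Bmod [Module.Finite ℤ L] (hu : u * u = 1) (hut : ∀ x, u (t x) = -t (u x)) :
    Nat.card (Bmod t u) = 2 ^ Module.finrank ℤ (eigP t) *
      Nat.card (Submodule.map (Tel t).mkQ (LinearMap.range (u - 1))) := by
  rw [natCard_eq_natCard_ker_inf_mul_natCard_map (Bmod t u)
    (Submodule.factor (twoTel_le_Tel (t := t))), ker_factor_inf_Bmod hu hut,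
    natCard_range_of_ker_eq_two_smul, Bmod, ← Submodule.map_comp, Submodule.factor_comp_mk]
  intro a
  simp only [LinearMap.comp_apply, LinearMap.sub_apply, Module.End.one_apply,
    Submodule.subtype_apply, Submodule.mkQ_apply, Submodule.Quotient.mk_eq_zero]
  constructor
  · intro h
    obtain ⟨w, hw, hwa⟩ := mem_twoTel.1 h
    obtain ⟨p, hp, q, hq, rfl⟩ := (mem_Tel_iff hu hut).1 hw
    obtain ⟨-, haq⟩ := eq_and_eq_of_add_apply_eq hu hut (neg_mem a.2) a.2
      ((eigP t).smul_mem 2 hp) ((eigP t).smul_mem 2 hq) (by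
        rw [neg_add_eq_sub, ← hwa, map_smul, smul_add])
    exact ⟨⟨q, hq⟩, Subtype.ext haq⟩
  · rintro ⟨b, rfl⟩
    refine mem_twoTel.2 ⟨-b + u b, (mem_Tel_iff hu hut).2 ⟨-b, neg_mem b.2, b, b.2, rfl⟩, ?_⟩
    rw [Submodule.coe_smul, map_smul]
    module

end Dihedral

/-- With `d`, `e` the numbers of Jordan blocks of sizes 2, 1 for `u` on `L/Tel(t)`,
we have `B(t) ∩ B(u) = 0`, hence `|B(t)+B(u)| = |B(t)|·|B(u)| = 2^(n+3d+e)`. -/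
theorem bmod_t_inf_bmod_u {L : Type*} [AddCommGroup L]
    [Module.Free ℤ L] [Module.Finite ℤ L] (n d e : ℕ)
    (hrank : Module.finrank ℤ L = 2 * n)
    (t u : Module.End ℤ L) (ht : t * t = 1) (hu : u * u = 1)
    (hz : (t * u) * (t * u) = -1)
    (hd : Nat.card (Submodule.map (Tel t).mkQ (LinearMap.range (u - 1))) = 2 ^ d)
    (he : Nat.card (Submodule.map (Tel t).mkQ (Submodule.comap (u - 1) (Tel t)))
        = 2 ^ (d + e)) :
    Bmod t t ⊓ Bmod t u = ⊥ ∧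
      Nat.card (Bmod t t ⊔ Bmod t u : Submodule ℤ (L ⧸ twoTel t))
        = Nat.card (Bmod t t) * Nat.card (Bmod t u) ∧
      Nat.card (Bmod t t ⊔ Bmod t u : Submodule ℤ (L ⧸ twoTel t)) = 2 ^ (n + 3 * d + e) := by
  have hut := anticommute_apply ht hu hz
  have hdisj := disjoint_Bmod ht hu hut
  have hn : Module.finrank ℤ (eigP t) = n := by
    have := two_mul_finrank_eigP ht hu hut
    lia
  refine ⟨hdisj.eq_bot, natCard_sup_of_disjoint hdisj, ?_⟩
  rw [natCard_sup_of_disjoint hdisj, natCard_Bmod_self ht, natCard_quotient_Tel hu hut,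
    natCard_Bmod hu hut, hn, hd, he]
  ring
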